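/- Let f : ℤ² → ℝ be finitely supported with Σ_{m ∈ ℤ²} f(m) = 0. Then there exists exactly one function u : ℤ² → ℝ satisfying [Au](m) = f(m) for all m ∈ ℤ² and u(m) → 0 as |m| → ∞, namely the convolution u(m) = Σ_{n ∈ ℤ²} φ(m − n) f(n). -/

import Mathlib

open Real MeasureTheory Filter

/-- The integrand of the lattice fundamental solution. -/
noncomputable def latticeKernel (m : ℤ × ℤ) (t : ℝ × ℝ) : ℝ :=
  (Real.cos (t.1 * (m.1 : ℝ) + t.2 * (m.2 : ℝ)) - 1) /
    (4 * Real.sin (t.1 / 2) ^ 2 + 4 * Real.sin (t.2 / 2) ^ 2)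

/-- The lattice fundamental solution `φ`. -/
noncomputable def phi (m : ℤ × ℤ) : ℝ :=
  (1 / (2 * Real.pi) ^ 2) *
    ∫ t in Set.Icc (-Real.pi) Real.pi ×ˢ Set.Icc (-Real.pi) Real.pi, latticeKernel m t

/-- The discrete Laplace operator on `ℤ²`. -/
noncomputable def discLap (u : ℤ × ℤ → ℝ) (m : ℤ × ℤ) : ℝ :=
  4 * u m - u (m + (1, 0)) - u (m - (1, 0)) - u (m + (0, 1)) - u (m - (0, 1))

/-- The Euclidean norm `|m| = √(m₁² + m₂²)` of a lattice point. -/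
noncomputable def latNorm (m : ℤ × ℤ) : ℝ :=
  Real.sqrt ((m.1 : ℝ) ^ 2 + (m.2 : ℝ) ^ 2)

/-- Convolution with the lattice fundamental solution: `[Sf](m) = Σₙ φ(m−n) f(n)`. -/
noncomputable def latConv (f : ℤ × ℤ → ℝ) (m : ℤ × ℤ) : ℝ :=
  ∑ᶠ n : ℤ × ℤ, phi (m - n) * f n

open scoped Topology

/-- The symbol `4 sin²(t₁/2) + 4 sin²(t₂/2)` of the discrete Laplace operator. -/
noncomputable def latticeSymbol (t : ℝ × ℝ) : ℝ :=
  4 * Real.sin (t.1 / 2) ^ 2 + 4 * Real.sin (t.2 / 2) ^ 2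

/-- The Brillouin zone `[-π, π]²`. -/
def latticeBox : Set (ℝ × ℝ) :=
  Set.Icc (-Real.pi) Real.pi ×ˢ Set.Icc (-Real.pi) Real.pi

/-- The phase `t₁ m₁ + t₂ m₂`. -/
def latticePhase (m : ℤ × ℤ) (t : ℝ × ℝ) : ℝ := t.1 * (m.1 : ℝ) + t.2 * (m.2 : ℝ)

theorem continuous_latticePhase (m : ℤ × ℤ) : Continuous (latticePhase m) := by
  unfold latticePhase; fun_prop

theorem continuous_latticeSymbol : Continuous latticeSymbol := by
  unfold latticeSymbol; fun_prop

theorem measurableSet_latticeBox : MeasurableSet latticeBox :=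
  measurableSet_Icc.prod measurableSet_Icc

theorem volume_restrict_latticeBox :
    (volume : Measure (ℝ × ℝ)).restrict latticeBox =
      (volume.restrict (Set.Icc (-π) π)).prod (volume.restrict (Set.Icc (-π) π)) := by
  rw [Measure.prod_restrict]; rfl

theorem latticePhase_sub (m n : ℤ × ℤ) (t : ℝ × ℝ) :
    latticePhase (m - n) t = latticePhase m t - latticePhase n t := by
  simp only [latticePhase, Prod.fst_sub, Prod.snd_sub]; push_cast; ring

theorem abs_latticePhase_le (m : ℤ × ℤ) (t : ℝ × ℝ) :
    |latticePhase m t| ≤ (|(m.1 : ℝ)| + |(m.2 : ℝ)|) * (|t.1| + |t.2|) := by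
  unfold latticePhase
  refine (abs_add_le _ _).trans ?_
  rw [abs_mul, abs_mul]
  nlinarith [abs_nonneg t.1, abs_nonneg t.2, abs_nonneg (m.1 : ℝ), abs_nonneg (m.2 : ℝ),
    mul_nonneg (abs_nonneg t.1) (abs_nonneg (m.2 : ℝ)),
    mul_nonneg (abs_nonneg t.2) (abs_nonneg (m.1 : ℝ))]

theorem sq_le_four_mul_sin_sq {x : ℝ} (hx : x ∈ Set.Icc (-π) π) :
    4 / π ^ 2 * x ^ 2 ≤ 4 * Real.sin (x / 2) ^ 2 := by
  have hx2 : |x / 2| ≤ π / 2 := by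
    rw [abs_div, abs_two]
    exact div_le_div_of_nonneg_right (abs_le.2 hx) two_pos.le
  have h := pow_le_pow_left₀ (by positivity) (Real.mul_abs_le_abs_sin hx2) 2
  rw [mul_pow, sq_abs, sq_abs] at h
  calc 4 / π ^ 2 * x ^ 2 = 4 * ((2 / π) ^ 2 * (x / 2) ^ 2) := by ring
    _ ≤ _ := by linarith

theorem sq_add_sq_le_latticeSymbol {t : ℝ × ℝ} (ht : t ∈ latticeBox) :
    4 / π ^ 2 * (t.1 ^ 2 + t.2 ^ 2) ≤ latticeSymbol t := by
  rw [mul_add]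
  exact add_le_add (sq_le_four_mul_sin_sq ht.1) (sq_le_four_mul_sin_sq ht.2)

theorem integrableOn_inv_sqrt_abs :
    IntegrableOn (fun x : ℝ => (√|x|)⁻¹) (Set.Icc (-π) π) := by
  rw [← intervalIntegrable_iff_integrableOn_Icc_of_le (by linarith [pi_pos])]
  refine intervalIntegrable_of_even (fun x => by rw [abs_neg]) (fun x hx => ?_)
    enorm_ne_top enorm_ne_top
  refine (intervalIntegral.intervalIntegrable_rpow' (r := -(1 / 2)) (by norm_num)).congr ?_
  intro y hy
  rw [Set.uIoc_of_le hx.le] at hy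
  simp only
  rw [abs_of_pos hy.1, Real.rpow_neg hy.1.le, Real.sqrt_eq_rpow]

theorem div_latticeSymbol_le {t : ℝ × ℝ} (ht : t ∈ latticeBox) (h1 : t.1 ≠ 0) (h2 : t.2 ≠ 0) :
    (|t.1| + |t.2|) / latticeSymbol t ≤ π ^ 2 / 4 * ((√|t.1|)⁻¹ * (√|t.2|)⁻¹) := by
  have hs := sq_add_sq_le_latticeSymbol ht
  obtain ⟨ha, hb⟩ := And.intro (Real.sqrt_pos.2 (abs_pos.2 h1)) (Real.sqrt_pos.2 (abs_pos.2 h2))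
  have ha2 := Real.sq_sqrt (abs_nonneg t.1)
  have hb2 := Real.sq_sqrt (abs_nonneg t.2)
  rw [← sq_abs t.1, ← sq_abs t.2] at hs
  generalize √|t.1| = a at *
  generalize √|t.2| = b at *
  rw [← ha2, ← hb2] at hs ⊢
  have hpos : 0 < 4 / π ^ 2 * ((a ^ 2) ^ 2 + (b ^ 2) ^ 2) := by positivity
  refine (div_le_div_of_nonneg_left (by positivity) hpos hs).trans ?_
  rw [div_le_iff₀ hpos]
  have : π ^ 2 / 4 * (a⁻¹ * b⁻¹) * (4 / π ^ 2 * ((a ^ 2) ^ 2 + (b ^ 2) ^ 2)) =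
      ((a ^ 2) ^ 2 + (b ^ 2) ^ 2) / (a * b) := by
    field_simp
  rw [this, le_div_iff₀ (by positivity)]
  nlinarith [sq_nonneg (a - b), sq_nonneg (a ^ 2 - b ^ 2), sq_nonneg (a + b),
    mul_nonneg (add_nonneg (sq_nonneg a) (sq_nonneg b)) (sq_nonneg (a - b))]

theorem ae_prod_ne_zero :
    ∀ᵐ t : ℝ × ℝ, t.1 ≠ 0 ∧ t.2 ≠ 0 := by
  have h : ∀ᵐ x : ℝ, x ≠ 0 := Measure.ae_ne volume 0
  exact (Measure.quasiMeasurePreserving_fst.ae h).and (Measure.quasiMeasurePreserving_snd.ae h)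

/-- Quotients by the symbol are integrable over the Brillouin zone as soon as the numerator
vanishes to first order at the origin. -/
theorem integrableOn_inv_latticeSymbol_smul {E : Type*} [NormedAddCommGroup E] [NormedSpace ℝ E]
    [SecondCountableTopology E] {g : ℝ × ℝ → E} (hg : Continuous g) (C : ℝ)
    (hC : ∀ t, ‖g t‖ ≤ C * (|t.1| + |t.2|)) :
    IntegrableOn (fun t => (latticeSymbol t)⁻¹ • g t) latticeBox := by
  have hw : IntegrableOn (fun t : ℝ × ℝ => C * (π ^ 2 / 4 * ((√|t.1|)⁻¹ * (√|t.2|)⁻¹)))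
      latticeBox := by
    unfold IntegrableOn
    rw [volume_restrict_latticeBox]
    exact ((Integrable.mul_prod integrableOn_inv_sqrt_abs integrableOn_inv_sqrt_abs).const_mul
      _).const_mul _
  have hC0 : 0 ≤ C := by
    have := (norm_nonneg _).trans (hC (1, 0))
    simpa using this
  refine Integrable.mono' hw ?_ ?_
  · borelize E
    exact (continuous_latticeSymbol.measurable.inv.smul hg.measurable).aestronglyMeasurable
  · filter_upwards [ae_restrict_mem measurableSet_latticeBox, ae_restrict_of_ae ae_prod_ne_zero]
      with t ht h0
    have hnn : 0 ≤ latticeSymbol t := by unfold latticeSymbol; positivity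
    rw [norm_smul, norm_inv, Real.norm_of_nonneg hnn]
    calc (latticeSymbol t)⁻¹ * ‖g t‖ ≤ (latticeSymbol t)⁻¹ * (C * (|t.1| + |t.2|)) := by
          gcongr; exact hC t
      _ = C * ((|t.1| + |t.2|) / latticeSymbol t) := by ring
      _ ≤ _ := by gcongr; exact div_latticeSymbol_le ht h0.1 h0.2

theorem integrableOn_latticeKernel (m : ℤ × ℤ) : IntegrableOn (latticeKernel m) latticeBox := by
  have hg : Continuous fun t => Real.cos (latticePhase m t) - 1 :=
    (Real.continuous_cos.comp (continuous_latticePhase m)).sub continuous_const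
  refine (integrableOn_inv_latticeSymbol_smul hg (|(m.1 : ℝ)| + |(m.2 : ℝ)|)
    fun t => ?_).congr_fun (fun t _ => ?_) measurableSet_latticeBox
  · have := Real.abs_cos_sub_cos_le (latticePhase m t) 0
    rw [Real.cos_zero, sub_zero] at this
    exact this.trans (abs_latticePhase_le m t)
  · simp only [latticeKernel, latticeSymbol, latticePhase, smul_eq_mul]; ring

theorem phi_eq (m : ℤ × ℤ) :
    phi m = 1 / (2 * π) ^ 2 * ∫ t in latticeBox, latticeKernel m t := rfl

theorem integral_cos_int_mul (k : ℤ) :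
    ∫ x in Set.Icc (-π) π, Real.cos (x * k) = if k = 0 then 2 * π else 0 := by
  rw [integral_Icc_eq_integral_Ioc,
    ← intervalIntegral.integral_of_le (by linarith [pi_pos])]
  split_ifs with hk
  · simp [hk]; ring
  · have hk' : (k : ℝ) ≠ 0 := Int.cast_ne_zero.2 hk
    rw [intervalIntegral.integral_comp_mul_right (fun x => Real.cos x) hk', integral_cos]
    simp [mul_comm π, Real.sin_int_mul_pi]

theorem integral_sin_int_mul (k : ℤ) :
    ∫ x in Set.Icc (-π) π, Real.sin (x * k) = 0 := by
  rw [integral_Icc_eq_integral_Ioc,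
    ← intervalIntegral.integral_of_le (by linarith [pi_pos])]
  by_cases hk : k = 0
  · simp [hk]
  · have hk' : (k : ℝ) ≠ 0 := Int.cast_ne_zero.2 hk
    rw [intervalIntegral.integral_comp_mul_right (fun x => Real.sin x) hk', integral_sin]
    simp

theorem integral_cos_latticePhase (m : ℤ × ℤ) :
    ∫ t in latticeBox, Real.cos (latticePhase m t) = if m = 0 then (2 * π) ^ 2 else 0 := by
  have hc : ∀ k : ℤ, Integrable (fun x : ℝ => Real.cos (x * k))
      (volume.restrict (Set.Icc (-π) π)) := fun k =>
    Continuous.integrableOn_Icc (by fun_prop)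
  have hs : ∀ k : ℤ, Integrable (fun x : ℝ => Real.sin (x * k))
      (volume.restrict (Set.Icc (-π) π)) := fun k =>
    Continuous.integrableOn_Icc (by fun_prop)
  simp only [latticePhase, Real.cos_add]
  rw [volume_restrict_latticeBox, integral_sub ((hc _).mul_prod (hc _)) ((hs _).mul_prod (hs _)),
    integral_prod_mul (fun x => Real.cos (x * m.1)) (fun x => Real.cos (x * m.2)),
    integral_prod_mul (fun x => Real.sin (x * m.1)) (fun x => Real.sin (x * m.2)),
    integral_cos_int_mul, integral_cos_int_mul, integral_sin_int_mul]
  simp only [Prod.ext_iff, Prod.fst_zero, Prod.snd_zero]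
  by_cases h1 : m.1 = 0 <;> by_cases h2 : m.2 = 0 <;> simp [h1, h2, sq]

theorem discLap_latticeKernel (m : ℤ × ℤ) {t : ℝ × ℝ} (ht : latticeSymbol t ≠ 0) :
    discLap (fun k => latticeKernel k t) m = Real.cos (latticePhase m t) := by
  have hs : latticeSymbol t = 4 - 2 * Real.cos t.1 - 2 * Real.cos t.2 := by
    have h1 := Real.cos_sq' (t.1 / 2)
    have h2 := Real.cos_sq' (t.2 / 2)
    have h3 := Real.cos_two_mul (t.1 / 2)
    have h4 := Real.cos_two_mul (t.2 / 2)
    rw [mul_div_cancel₀ _ two_ne_zero] at h3 h4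
    unfold latticeSymbol
    linarith
  have hk : ∀ k, latticeKernel k t = (Real.cos (latticePhase k t) - 1) / latticeSymbol t :=
    fun _ => rfl
  have e1 : latticePhase (m + (1, 0)) t = latticePhase m t + t.1 := by simp [latticePhase]; ring
  have e2 : latticePhase (m - (1, 0)) t = latticePhase m t - t.1 := by simp [latticePhase]; ring
  have e3 : latticePhase (m + (0, 1)) t = latticePhase m t + t.2 := by simp [latticePhase]; ring
  have e4 : latticePhase (m - (0, 1)) t = latticePhase m t - t.2 := by simp [latticePhase]; ring
  simp only [discLap, hk, e1, e2, e3, e4]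
  field_simp
  rw [hs]
  simp only [Real.cos_add, Real.cos_sub]
  ring

theorem discLap_phi (m : ℤ × ℤ) : discLap phi m = if m = 0 then 1 else 0 := by
  have hi := integrableOn_latticeKernel
  have h : discLap phi m =
      1 / (2 * π) ^ 2 * ∫ t in latticeBox, discLap (fun k => latticeKernel k t) m := by
    simp only [discLap, phi_eq]
    rw [integral_sub, integral_sub, integral_sub, integral_sub, integral_const_mul]
    · ring
    · exact (hi m).const_mul 4
    · exact hi _
    · exact ((hi m).const_mul 4).sub (hi _)
    · exact hi _
    · exact (((hi m).const_mul 4).sub (hi _)).sub (hi _)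
    · exact hi _
    · exact ((((hi m).const_mul 4).sub (hi _)).sub (hi _)).sub (hi _)
    · exact hi _
  have h' : ∫ t in latticeBox, discLap (fun k => latticeKernel k t) m =
      ∫ t in latticeBox, Real.cos (latticePhase m t) := by
    refine integral_congr_ae ?_
    filter_upwards [ae_restrict_mem measurableSet_latticeBox, ae_restrict_of_ae ae_prod_ne_zero]
      with t ht h0
    refine discLap_latticeKernel m (ne_of_gt ?_)
    have h1 := h0.1
    exact lt_of_lt_of_le (by positivity) (sq_add_sq_le_latticeSymbol ht)
  rw [h, h', integral_cos_latticePhase]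
  split_ifs
  · field_simp
  · simp

/-- The functional `t ↦ (t₁ m₁ + t₂ m₂) / 2π`, up to the sign used by the Fourier character. -/
noncomputable def latticeDual (m : ℤ × ℤ) : StrongDual ℝ (ℝ × ℝ) :=
  (-(m.1 : ℝ) / (2 * π)) • ContinuousLinearMap.fst ℝ ℝ ℝ +
    (-(m.2 : ℝ) / (2 * π)) • ContinuousLinearMap.snd ℝ ℝ ℝ

theorem neg_latticeDual_apply (m : ℤ × ℤ) (t : ℝ × ℝ) :
    2 * π * -latticeDual m t = latticePhase m t := by
  simp [latticeDual, latticePhase]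
  field_simp
  ring

theorem latNorm_le_norm_latticeDual (m : ℤ × ℤ) : latNorm m ≤ 4 * π * ‖latticeDual m‖ := by
  have h1 := (latticeDual m).le_opNorm (1, 0)
  have h2 := (latticeDual m).le_opNorm (0, 1)
  have e1 : |(m.1 : ℝ)| = 2 * π * ‖latticeDual m (1, 0)‖ := by
    simp [latticeDual, abs_of_pos pi_pos]; field_simp
  have e2 : |(m.2 : ℝ)| = 2 * π * ‖latticeDual m (0, 1)‖ := by
    simp [latticeDual, abs_of_pos pi_pos]; field_simp
  simp only [Prod.norm_mk, norm_one, norm_zero, zero_le_one, sup_of_le_left, sup_of_le_right,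
    mul_one] at h1 h2
  have h3 : latNorm m ≤ |(m.1 : ℝ)| + |(m.2 : ℝ)| := by
    refine Real.sqrt_le_iff.2 ⟨by positivity, ?_⟩
    rw [← sq_abs (m.1 : ℝ), ← sq_abs (m.2 : ℝ)]
    nlinarith [mul_nonneg (abs_nonneg (m.1 : ℝ)) (abs_nonneg (m.2 : ℝ))]
  have := pi_pos
  calc latNorm m ≤ 2 * π * ‖latticeDual m (1, 0)‖ + 2 * π * ‖latticeDual m (0, 1)‖ := by
        rwa [← e1, ← e2]
    _ ≤ 2 * π * ‖latticeDual m‖ + 2 * π * ‖latticeDual m‖ := by gcongr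
    _ = _ := by ring

theorem tendsto_latticeDual :
    Tendsto latticeDual (comap latNorm atTop) (cocompact (StrongDual ℝ (ℝ × ℝ))) := by
  rw [← Metric.cobounded_eq_cocompact, ← comap_norm_atTop, tendsto_comap_iff]
  refine Tendsto.atTop_of_const_mul₀ (c := 4 * π) (by positivity) ?_
  exact tendsto_atTop_mono latNorm_le_norm_latticeDual tendsto_comap

theorem phi_sub_sub_phi (n m : ℤ × ℤ) :
    phi (m - n) - phi m = 1 / (2 * π) ^ 2 *
      (∫ t, Real.fourierChar (-latticeDual m t) • latticeBox.indicator (fun t =>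
        (latticeSymbol t)⁻¹ • (Complex.exp (Complex.I * (-latticePhase n t : ℝ)) - 1)) t).re := by
  have hi := integrableOn_latticeKernel
  set F : ℝ × ℝ → ℂ := fun t =>
    (latticeSymbol t)⁻¹ • (Complex.exp (Complex.I * (-latticePhase n t : ℝ)) - 1) with hF
  have hind : ∀ t, Real.fourierChar (-latticeDual m t) • latticeBox.indicator F t =
      latticeBox.indicator (fun t => Real.fourierChar (-latticeDual m t) • F t) t := fun t => by
    by_cases ht : t ∈ latticeBox <;> simp [ht]
  have hFi : IntegrableOn F latticeBox := by
    have hp := continuous_latticePhase n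
    refine integrableOn_inv_latticeSymbol_smul (by fun_prop) (|(n.1 : ℝ)| + |(n.2 : ℝ)|)
      fun t => ?_
    refine Real.norm_exp_I_mul_ofReal_sub_one_le.trans ?_
    rw [norm_neg]
    exact abs_latticePhase_le n t
  have hGi : IntegrableOn (fun t => Real.fourierChar (-latticeDual m t) • F t) latticeBox := by
    refine Integrable.mono hFi ?_ (ae_of_all _ fun t => by simp)
    have hc : Continuous fun t => (Real.fourierChar (-latticeDual m t) : ℂ) := by fun_prop
    exact hc.aestronglyMeasurable.smul hFi.aestronglyMeasurable
  simp only [hind]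
  rw [integral_indicator measurableSet_latticeBox, phi_eq, phi_eq, ← mul_sub,
    ← integral_sub (hi _) (hi _)]
  congr 1
  refine Eq.trans ?_ (integral_re hGi)
  refine integral_congr_ae (ae_of_all _ fun t => ?_)
  have hk : ∀ k, latticeKernel k t = (Real.cos (latticePhase k t) - 1) / latticeSymbol t :=
    fun _ => rfl
  simp only [hk, hF, Circle.smul_def, Real.fourierChar_apply, neg_latticeDual_apply]
  rw [latticePhase_sub, smul_comm, smul_eq_mul, mul_sub, ← Complex.exp_add, mul_one,
    show (latticePhase m t : ℂ) * Complex.I + Complex.I * ((-latticePhase n t : ℝ) : ℂ) =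
      ((latticePhase m t - latticePhase n t : ℝ) : ℂ) * Complex.I by push_cast; ring]
  simp only [RCLike.re_to_complex, Complex.smul_re, Complex.sub_re, Complex.exp_ofReal_mul_I_re,
    smul_eq_mul]
  ring

theorem tendsto_phi_sub_sub_phi (n : ℤ × ℤ) :
    Tendsto (fun m => phi (m - n) - phi m) (comap latNorm atTop) (𝓝 0) := by
  simp only [phi_sub_sub_phi]
  have h := (tendsto_integral_exp_smul_cocompact (latticeBox.indicator (fun t =>
    (latticeSymbol t)⁻¹ • (Complex.exp (Complex.I * (-latticePhase n t : ℝ)) - 1)))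
    (volume : Measure (ℝ × ℝ))).comp tendsto_latticeDual
  have h' := ((Complex.continuous_re.tendsto 0).comp h).const_mul (1 / (2 * π) ^ 2)
  simpa using h'

theorem finite_latNorm_le (R : ℝ) : {m : ℤ × ℤ | latNorm m ≤ R}.Finite := by
  refine ((Set.finite_Icc (-⌈R⌉) ⌈R⌉).prod (Set.finite_Icc (-⌈R⌉) ⌈R⌉)).subset fun m hm => ?_
  have hm : latNorm m ≤ R := hm
  have h1 : |(m.1 : ℝ)| ≤ ⌈R⌉ :=
    ((Real.abs_le_sqrt (by nlinarith [sq_nonneg (m.2 : ℝ)])).trans hm).trans (Int.le_ceil R)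
  have h2 : |(m.2 : ℝ)| ≤ ⌈R⌉ :=
    ((Real.abs_le_sqrt (by nlinarith [sq_nonneg (m.1 : ℝ)])).trans hm).trans (Int.le_ceil R)
  rw [abs_le] at h1 h2
  exact ⟨⟨by exact_mod_cast h1.1, by exact_mod_cast h1.2⟩,
    ⟨by exact_mod_cast h2.1, by exact_mod_cast h2.2⟩⟩

theorem finite_le_of_tendsto {v : ℤ × ℤ → ℝ} (hv : Tendsto v (comap latNorm atTop) (𝓝 0))
    {c : ℝ} (hc : 0 < c) : {m | c ≤ v m}.Finite := by
  have h := hv.eventually_lt_const hc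
  rw [eventually_comap] at h
  obtain ⟨R, hR⟩ := eventually_atTop.1 h
  refine (finite_latNorm_le R).subset fun m hm => ?_
  by_contra hlt
  exact (not_lt.2 hm) (hR (latNorm m) (not_le.1 hlt).le m rfl)

/-- Maximum principle: a discrete harmonic function decaying at infinity is nowhere positive. -/
theorem nonpos_of_discLap_eq_zero {v : ℤ × ℤ → ℝ} (hv : Tendsto v (comap latNorm atTop) (𝓝 0))
    (hh : ∀ m, discLap v m = 0) (m : ℤ × ℤ) : v m ≤ 0 := by
  by_contra! hpos
  obtain ⟨p, hp, hmax⟩ :=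
    Set.exists_max_image _ v (finite_le_of_tendsto hv hpos) ⟨m, le_refl (v m)⟩
  have hp : v m ≤ v p := hp
  have hle : ∀ q, v q ≤ v p := fun q => by
    rcases le_or_gt (v m) (v q) with h | h
    · exact hmax q h
    · exact h.le.trans hp
  obtain ⟨q, hq, hright⟩ := Set.exists_max_image _ Prod.fst
    (finite_le_of_tendsto hv (hpos.trans_le hp)) ⟨p, le_refl (v p)⟩
  have hq : v p ≤ v q := hq
  have hstep : v p ≤ v (q + (1, 0)) := by
    have := hh q
    unfold discLap at this
    linarith [hle (q - (1, 0)), hle (q + (0, 1)), hle (q - (0, 1))]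
  have := hright _ hstep
  simp at this

theorem eq_zero_of_discLap_eq_zero {v : ℤ × ℤ → ℝ} (hv : Tendsto v (comap latNorm atTop) (𝓝 0))
    (hh : ∀ m, discLap v m = 0) (m : ℤ × ℤ) : v m = 0 := by
  refine le_antisymm (nonpos_of_discLap_eq_zero hv hh m) ?_
  have h := nonpos_of_discLap_eq_zero (v := fun k => -v k) (by simpa using hv.neg) (fun k => by
    have := hh k
    unfold discLap at this ⊢
    linarith) m
  linarith

theorem latConv_eq_sum {f : ℤ × ℤ → ℝ} (hf : (Function.support f).Finite) (m : ℤ × ℤ) :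
    latConv f m = ∑ n ∈ hf.toFinset, phi (m - n) * f n :=
  finsum_eq_sum_of_support_subset _ fun n hn => by
    simpa using right_ne_zero_of_mul (Function.mem_support.1 hn)

theorem discLap_latConv {f : ℤ × ℤ → ℝ} (hf : (Function.support f).Finite) (m : ℤ × ℤ) :
    discLap (latConv f) m = f m := by
  have h : discLap (latConv f) m = ∑ n ∈ hf.toFinset, discLap phi (m - n) * f n := by
    simp only [discLap, latConv_eq_sum hf, Finset.mul_sum, ← Finset.sum_sub_distrib]
    refine Finset.sum_congr rfl fun n _ => ?_
    rw [add_sub_right_comm, sub_right_comm, add_sub_right_comm m (0, 1), sub_right_comm m (0, 1)]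
    ring_nf
  simp only [h, discLap_phi, sub_eq_zero, ite_mul, one_mul, zero_mul, Finset.sum_ite_eq,
    Set.Finite.mem_toFinset, Function.mem_support]
  split_ifs with h0
  · rfl
  · exact (not_not.1 h0).symm

theorem tendsto_latConv {f : ℤ × ℤ → ℝ} (hf : (Function.support f).Finite)
    (hsum : ∑ᶠ m : ℤ × ℤ, f m = 0) :
    Tendsto (latConv f) (comap latNorm atTop) (𝓝 0) := by
  rw [finsum_eq_sum f hf] at hsum
  have h : latConv f = fun m => ∑ n ∈ hf.toFinset, (phi (m - n) - phi m) * f n := by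
    funext m
    simp only [latConv_eq_sum hf, sub_mul, Finset.sum_sub_distrib, ← Finset.mul_sum, hsum]
    ring
  rw [h]
  simpa using tendsto_finsetSum hf.toFinset fun n _ =>
    (tendsto_phi_sub_sub_phi n).mul_const (f n)

/-- Well-posedness of the free-space lattice Poisson problem: for finitely supported
`f` with total charge zero, a function `u` solves `Au = f` and decays at infinity
if and only if `u` is the convolution `φ * f`.  In particular there is exactly one
such solution, namely the convolution. -/
theorem lattice_poisson_wellposed (f : ℤ × ℤ → ℝ)
    (hf : (Function.support f).Finite) (hsum : ∑ᶠ m : ℤ × ℤ, f m = 0) :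
    ∀ u : ℤ × ℤ → ℝ,
      ((∀ m : ℤ × ℤ, discLap u m = f m) ∧
        Filter.Tendsto u (Filter.comap latNorm Filter.atTop) (nhds 0))
      ↔ u = latConv f := by
  intro u
  constructor
  · rintro ⟨hu, hu0⟩
    funext m
    refine sub_eq_zero.1 (eq_zero_of_discLap_eq_zero (v := fun k => u k - latConv f k)
      (by simpa using hu0.sub (tendsto_latConv hf hsum)) (fun k => ?_) m)
    have h1 := hu k
    have h2 := discLap_latConv hf k
    unfold discLap at h1 h2 ⊢
    linarith
  · rintro rfl
    exact ⟨discLap_latConv hf, tendsto_latConv hf hsum⟩
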